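/- Let H be a real Hilbert space, let W and W_m be positive self-adjoint bounded linear operators on H with ‖W‖ ≤ κ² and ‖W_m‖ ≤ κ², let λ > 0, and let h ∈ H with ‖h‖² ≤ κ². Then |⟨(W_m + λI)^{-2} W_m h, h⟩ − ⟨(W + λI)^{-2} W h, h⟩| ≤ κ²(λ² + κ⁴)/λ⁴ · ‖W_m − W‖, where ‖·‖ on the right-hand side is the operator norm. -/

import Mathlib

open RealInnerProductSpace

section ShiftedPositiveOperator

variable {H : Type*} [NormedAddCommGroup H] [InnerProductSpace ℝ H]

theorem ContinuousLinearMap.IsPositive.mul_norm_sq_le_inner_add_smul_one {T : H →L[ℝ] H}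
    (hT : T.IsPositive) (c : ℝ) (x : H) :
    c * ‖x‖ ^ 2 ≤ ⟪(T + c • (1 : H →L[ℝ] H)) x, x⟫ := by
  have h0 : 0 ≤ ⟪T x, x⟫ := hT.inner_nonneg_left x
  have h1 : ⟪(T + c • (1 : H →L[ℝ] H)) x, x⟫ = ⟪T x, x⟫ + c * ‖x‖ ^ 2 := by
    simp [inner_add_left, real_inner_smul_left]
  linarith

theorem ContinuousLinearMap.IsPositive.mul_norm_le_norm_add_smul_one {T : H →L[ℝ] H}
    (hT : T.IsPositive) (c : ℝ) (x : H) :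
    c * ‖x‖ ≤ ‖(T + c • (1 : H →L[ℝ] H)) x‖ := by
  rcases (norm_nonneg x).eq_or_lt with hx | hx
  · simp [← hx]
  · have h1 := (hT.mul_norm_sq_le_inner_add_smul_one c x).trans (real_inner_le_norm _ _)
    exact le_of_mul_le_mul_right (by linarith) hx

theorem ContinuousLinearMap.IsPositive.isUnit_add_smul_one [CompleteSpace H] {T : H →L[ℝ] H}
    (hT : T.IsPositive) {c : ℝ} (hc : 0 < c) :
    IsUnit (T + c • (1 : H →L[ℝ] H)) := by
  refine ContinuousLinearMap.isUnit_of_forall_le_norm_inner_map _ (c := ⟨c, hc.le⟩) hc fun x => ?_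
  have h1 := (hT.mul_norm_sq_le_inner_add_smul_one c x).trans (le_abs_self _)
  rw [Real.norm_eq_abs]
  exact (mul_comm _ _).trans_le h1

theorem ContinuousLinearMap.IsPositive.norm_inverse_add_smul_one_le [CompleteSpace H]
    {T : H →L[ℝ] H} (hT : T.IsPositive) {c : ℝ} (hc : 0 < c) :
    ‖Ring.inverse (T + c • (1 : H →L[ℝ] H))‖ ≤ c⁻¹ := by
  refine ContinuousLinearMap.opNorm_le_bound _ (by positivity) fun x => ?_
  have h1 := hT.mul_norm_le_norm_add_smul_one c (Ring.inverse (T + c • (1 : H →L[ℝ] H)) x)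
  rw [← mul_apply_eq_comp, Ring.mul_inverse_cancel _ (hT.isUnit_add_smul_one hc),
    one_apply_eq_self] at h1
  rwa [inv_mul_eq_div, le_div_iff₀' hc]

end ShiftedPositiveOperator

theorem inverse_sq_mul_sub_inverse_sq_mul {R A : Type*} [CommRing R] [Ring A] [Algebra R A]
    (S T : A) (c : R) (hS : IsUnit (S + c • (1 : A))) (hT : IsUnit (T + c • (1 : A))) :
    Ring.inverse (S + c • (1 : A)) ^ 2 * S - Ring.inverse (T + c • (1 : A)) ^ 2 * T
      = Ring.inverse (S + c • (1 : A)) ^ 2 * (c ^ 2 • (S - T) - S * (S - T) * T)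
        * Ring.inverse (T + c • (1 : A)) ^ 2 := by
  have key : c ^ 2 • (S - T) - S * (S - T) * T
      = S * (T + c • (1 : A)) ^ 2 - (S + c • (1 : A)) ^ 2 * T := by
    simp only [sq, mul_add, add_mul, mul_sub, sub_mul, smul_mul_assoc, mul_smul_comm, mul_one,
      one_mul, smul_sub, smul_add, smul_smul, mul_assoc]
    abel
  have hcomm : Commute T (T + c • (1 : A)) :=
    (Commute.refl T).add_right ((Commute.one_right T).smul_right c)
  have hcomm_inv : T * Ring.inverse (T + c • (1 : A)) ^ 2
      = Ring.inverse (T + c • (1 : A)) ^ 2 * T := by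
    refine Commute.pow_right ?_ 2
    obtain ⟨u, hu⟩ := hT
    rw [← hu, Ring.inverse_unit]
    exact (hu ▸ hcomm : Commute T (u : A)).units_inv_right
  have cancel_left : ∀ {U : A}, IsUnit U → Ring.inverse U ^ 2 * U ^ 2 = 1 := fun {U} hU => by
    rw [sq, sq, mul_assoc, Ring.inverse_mul_cancel_left _ _ hU, Ring.inverse_mul_cancel _ hU]
  have cancel_right : ∀ {U : A}, IsUnit U → U ^ 2 * Ring.inverse U ^ 2 = 1 := fun {U} hU => by
    rw [sq, sq, mul_assoc, Ring.mul_inverse_cancel_left _ _ hU, Ring.mul_inverse_cancel _ hU]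
  rw [key, mul_sub, sub_mul, ← mul_assoc, mul_assoc _ (_ ^ 2) (_ ^ 2), cancel_right hT, mul_one,
    ← mul_assoc, cancel_left hS, one_mul, hcomm_inv]

/-- For positive self-adjoint bounded operators `W, W_m` with
`‖W‖ ≤ κ²`, `‖W_m‖ ≤ κ²`, `λ > 0` and `h ∈ H` with `‖h‖² ≤ κ²`,
`|⟨(W_m + λI)⁻² W_m h, h⟩ − ⟨(W + λI)⁻² W h, h⟩| ≤ κ²(λ² + κ⁴)/λ⁴ · ‖W_m − W‖`. -/
theorem regularized_energy_sample_error_bound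
    {H : Type*} [NormedAddCommGroup H] [InnerProductSpace ℝ H] [CompleteSpace H]
    (W Wm : H →L[ℝ] H) (hW : W.IsPositive) (hWm : Wm.IsPositive)
    (κ : ℝ) (hκ : 0 < κ) (hWnorm : ‖W‖ ≤ κ ^ 2) (hWmnorm : ‖Wm‖ ≤ κ ^ 2)
    (lam : ℝ) (hlam : 0 < lam) (h : H) (hh : ‖h‖ ^ 2 ≤ κ ^ 2) :
    |⟪((Ring.inverse (Wm + lam • (1 : H →L[ℝ] H))) ^ 2 * Wm) h, h⟫
        - ⟪((Ring.inverse (W + lam • (1 : H →L[ℝ] H))) ^ 2 * W) h, h⟫|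
      ≤ κ ^ 2 * (lam ^ 2 + κ ^ 4) / lam ^ 4 * ‖Wm - W‖ := by
  have hP := hW.norm_inverse_add_smul_one_le hlam
  have hQ := hWm.norm_inverse_add_smul_one_le hlam
  rw [← inner_sub_left, ← sub_apply,
    inverse_sq_mul_sub_inverse_sq_mul Wm W lam (hWm.isUnit_add_smul_one hlam)
      (hW.isUnit_add_smul_one hlam)]
  set P := Ring.inverse (W + lam • (1 : H →L[ℝ] H))
  set Q := Ring.inverse (Wm + lam • (1 : H →L[ℝ] H))
  have hmid : ‖lam ^ 2 • (Wm - W) - Wm * (Wm - W) * W‖ ≤ (lam ^ 2 + κ ^ 4) * ‖Wm - W‖ := by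
    calc ‖lam ^ 2 • (Wm - W) - Wm * (Wm - W) * W‖
        ≤ ‖lam ^ 2 • (Wm - W)‖ + ‖Wm * (Wm - W) * W‖ := norm_sub_le _ _
      _ ≤ lam ^ 2 * ‖Wm - W‖ + ‖Wm‖ * ‖Wm - W‖ * ‖W‖ := by
          gcongr
          · rw [norm_smul, Real.norm_of_nonneg (by positivity)]
          · exact norm_mul₃_le
      _ ≤ lam ^ 2 * ‖Wm - W‖ + κ ^ 2 * ‖Wm - W‖ * κ ^ 2 := by gcongr
      _ = (lam ^ 2 + κ ^ 4) * ‖Wm - W‖ := by ring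
  set M := lam ^ 2 • (Wm - W) - Wm * (Wm - W) * W
  calc |⟪(Q ^ 2 * M * P ^ 2) h, h⟫|
      ≤ ‖(Q ^ 2 * M * P ^ 2) h‖ * ‖h‖ := abs_real_inner_le_norm _ _
    _ ≤ ‖Q ^ 2 * M * P ^ 2‖ * ‖h‖ * ‖h‖ := by
        gcongr
        exact ContinuousLinearMap.le_opNorm _ _
    _ = ‖Q ^ 2 * M * P ^ 2‖ * ‖h‖ ^ 2 := by ring
    _ ≤ ‖Q‖ ^ 2 * ‖M‖ * ‖P‖ ^ 2 * ‖h‖ ^ 2 := by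
        gcongr
        refine norm_mul₃_le.trans ?_
        gcongr <;> exact norm_pow_le' _ two_pos
    _ ≤ lam⁻¹ ^ 2 * ((lam ^ 2 + κ ^ 4) * ‖Wm - W‖) * lam⁻¹ ^ 2 * κ ^ 2 := by gcongr
    _ = κ ^ 2 * (lam ^ 2 + κ ^ 4) / lam ^ 4 * ‖Wm - W‖ := by
        field_simp
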